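/- For all N ≥ 1, the variance of the function a−b with respect to μ_{N,0} equals ( m(m+2) + (N−1)(m+n)(m+n+2) ) / 12. -/

import Mathlib

open Finsupp Filter

noncomputable section

/-- Signed-sum convention: `signedSum c k = Σ_{i=0}^{k} c i`, which is the ordinary sum for
`k ≥ 0`, is `0` for `k = -1`, and equals `-(c (-1) + c (-2) + ⋯ + c (k+1))` for `k ≤ -2`. -/
def signedSum {M : Type*} [AddCommGroup M] (c : ℤ → M) (k : ℤ) : M :=
  (∑ i ∈ Finset.range (k + 1).toNat, c i) -
    ∑ i ∈ Finset.range (-(k + 1)).toNat, c (-((i : ℤ) + 1))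

/-- The Demazure operator `D₀` (relative to `Λ = mΛ₀ + nΛ₁`):
`D₀ δ_{(a,b)} = Σ_{i=0}^{m - 2(a-b)} δ_{(a+i,b)}`, extended ℤ-linearly. -/
def D0 (m : ℕ) (μ : ℤ × ℤ →₀ ℤ) : ℤ × ℤ →₀ ℤ :=
  μ.sum fun p c =>
    c • signedSum (fun i => Finsupp.single (p.1 + i, p.2) (1 : ℤ)) ((m : ℤ) - 2 * (p.1 - p.2))

/-- The Demazure operator `D₁` (relative to `Λ = mΛ₀ + nΛ₁`):
`D₁ δ_{(a,b)} = Σ_{i=0}^{n + 2(a-b)} δ_{(a,b+i)}`, extended ℤ-linearly. -/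
def D1 (n : ℕ) (μ : ℤ × ℤ →₀ ℤ) : ℤ × ℤ →₀ ℤ :=
  μ.sum fun p c =>
    c • signedSum (fun i => Finsupp.single (p.1, p.2 + i) (1 : ℤ)) ((n : ℤ) + 2 * (p.1 - p.2))

/-- Total mass `μ(Γ)` of a finitely supported function on `ℤ × ℤ`. -/
def mass (μ : ℤ × ℤ →₀ ℤ) : ℤ := μ.sum fun _ c => c

/-- Expected value `E_ν[f] = (1/ν(Γ)) Σ ν(a,b) f(a,b)`. -/
def expVal (ν : ℤ × ℤ →₀ ℤ) (f : ℤ × ℤ → ℚ) : ℚ :=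
  (mass ν : ℚ)⁻¹ * ν.sum fun p c => (c : ℚ) * f p

/-- Covariance `Cov_ν(f,g) = E_ν[f·g] - E_ν[f]·E_ν[g]`. -/
def cov (ν : ℤ × ℤ →₀ ℤ) (f g : ℤ × ℤ → ℚ) : ℚ :=
  expVal ν (fun p => f p * g p) - expVal ν f * expVal ν g

/-- Variance `Var_ν(f) = Cov_ν(f,f)`. -/
def var (ν : ℤ × ℤ →₀ ℤ) (f : ℤ × ℤ → ℚ) : ℚ := cov ν f f

/-- The coordinate function `a` (the degree). -/
def fa : ℤ × ℤ → ℚ := fun p => (p.1 : ℚ)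

/-- The coordinate function `b`. -/
def fb : ℤ × ℤ → ℚ := fun p => (p.2 : ℚ)

/-- The finite-weight coordinate `a - b`. -/
def fab : ℤ × ℤ → ℚ := fun p => (p.1 : ℚ) - (p.2 : ℚ)

/-- `μ_{N,0}`: start from `δ_{(0,0)}`, apply `D₀` at odd steps and `D₁` at even steps. -/
def mu0 (m n : ℕ) : ℕ → (ℤ × ℤ →₀ ℤ)
  | 0 => Finsupp.single (0, 0) 1
  | N + 1 => if N % 2 = 0 then D0 m (mu0 m n N) else D1 n (mu0 m n N)

/-- `μ_{N,1}`: start from `δ_{(0,0)}`, apply `D₁` at odd steps and `D₀` at even steps. -/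
def mu1 (m n : ℕ) : ℕ → (ℤ × ℤ →₀ ℤ)
  | 0 => Finsupp.single (0, 0) 1
  | N + 1 => if N % 2 = 0 then D1 n (mu1 m n N) else D0 m (mu1 m n N)

/-- The pairing `Σ ν(a,b) g(a,b)`, additive in `ν`. -/
def pairing (g : ℤ × ℤ → ℚ) : (ℤ × ℤ →₀ ℤ) →+ ℚ :=
  Finsupp.liftAddHom fun p => (AddMonoidHom.mulRight (g p)).comp (Int.castAddHom ℚ)

theorem pairing_apply (g : ℤ × ℤ → ℚ) (ν : ℤ × ℤ →₀ ℤ) :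
    pairing g ν = ν.sum fun p c => (c : ℚ) * g p := rfl

theorem pairing_single (g : ℤ × ℤ → ℚ) (p : ℤ × ℤ) (c : ℤ) :
    pairing g (single p c) = c * g p := by
  simp [pairing_apply]

theorem cast_mass (ν : ℤ × ℤ →₀ ℤ) : (mass ν : ℚ) = pairing (fun _ => 1) ν := by
  simp [mass, pairing_apply, Finsupp.sum]

theorem expVal_eq (ν : ℤ × ℤ →₀ ℤ) (f : ℤ × ℤ → ℚ) :
    expVal ν f = (pairing (fun _ => 1) ν)⁻¹ * pairing f ν := by
  rw [expVal, cast_mass, pairing_apply f]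

theorem map_signedSum {M M' : Type*} [AddCommGroup M] [AddCommGroup M'] (φ : M →+ M')
    (c : ℤ → M) (k : ℤ) : φ (signedSum c k) = signedSum (fun i => φ (c i)) k := by
  simp [signedSum]

theorem pairing_D0 (m : ℕ) (g : ℤ × ℤ → ℚ) (ν : ℤ × ℤ →₀ ℤ) :
    pairing g (D0 m ν) =
      pairing (fun p => signedSum (fun i => g (p.1 + i, p.2)) (m - 2 * (p.1 - p.2))) ν := by
  rw [D0, map_finsuppSum, pairing_apply]
  simp [map_zsmul, map_signedSum, pairing_single]

theorem pairing_D1 (n : ℕ) (g : ℤ × ℤ → ℚ) (ν : ℤ × ℤ →₀ ℤ) :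
    pairing g (D1 n ν) =
      pairing (fun p => signedSum (fun i => g (p.1, p.2 + i)) (n + 2 * (p.1 - p.2))) ν := by
  rw [D1, map_finsuppSum, pairing_apply]
  simp [map_zsmul, map_signedSum, pairing_single]

theorem signedSum_sub {M : Type*} [AddCommGroup M] (F : ℤ → M) (k : ℤ) :
    signedSum (fun i => F i - F (i - 1)) k = F k - F (-1) := by
  have pos (j : ℕ) : ∑ i ∈ Finset.range j, (F i - F (i - 1)) = F (j - 1) - F (-1) := by
    have h := Finset.sum_range_sub (fun i : ℕ => F ((i : ℤ) - 1)) j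
    simpa using h
  have neg (j : ℕ) : ∑ i ∈ Finset.range j, (F (-((i : ℤ) + 1)) - F (-((i : ℤ) + 1) - 1)) =
      F (-1) - F (-(j : ℤ) - 1) := by
    have h := Finset.sum_range_sub' (fun i : ℕ => F (-(i : ℤ) - 1)) j
    simpa [sub_eq_add_neg, add_comm] using h
  rw [signedSum, pos, neg]
  rcases le_total 0 (k + 1) with h | h
  · have h1 : (((k + 1).toNat : ℕ) : ℤ) = k + 1 := Int.toNat_of_nonneg h
    have h2 : (-(k + 1)).toNat = 0 := by omega
    rw [h1, h2]
    simp
  · have h1 : (((-(k + 1)).toNat : ℕ) : ℤ) = -(k + 1) := Int.toNat_of_nonneg (by omega)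
    have h2 : (k + 1).toNat = 0 := by omega
    rw [h1, h2]
    simp

/-- A cubic summed over an interval of unit steps from `y` to `-y`: odd powers cancel. -/
theorem signedSum_cubic (α β γ δ y : ℚ) (k : ℤ) (hk : (k : ℚ) = -2 * y) :
    signedSum (fun i : ℤ => α + β * (y + i) + γ * (y + i) ^ 2 + δ * (y + i) ^ 3) k =
      α * (k + 1) + γ * (((k : ℚ) + 1) ^ 3 - (k + 1)) / 12 := by
  have h := signedSum_sub (fun i : ℤ => α * (y + i) + β * ((y + i) * (y + i + 1) / 2) +
    γ * ((y + i) * (y + i + 1) * (2 * (y + i) + 1) / 6) +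
    δ * ((y + i) ^ 2 * (y + i + 1) ^ 2 / 4)) k
  have e : y = -k / 2 := by linarith
  convert h using 1
  · congr 1
    funext i
    push_cast
    ring
  · rw [e]
    push_cast
    ring

/-- Centred at `c`, the measure `ν` has mass `s`, second moment `s * V`, and vanishing first and
third moments for the function `a - b`. -/
def HasCentredMoments (ν : ℤ × ℤ →₀ ℤ) (c s V : ℚ) : Prop :=
  ∀ α β γ δ : ℚ, pairing (fun p => α + β * (fab p - c) + γ * (fab p - c) ^ 2 +
    δ * (fab p - c) ^ 3) ν = s * (α + γ * V)

theorem HasCentredMoments.D0 {ν : ℤ × ℤ →₀ ℤ} {c s V : ℚ} (h : HasCentredMoments ν c s V)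
    (m : ℕ) (M : ℚ) (hM : M = m + 1 - 2 * c) :
    HasCentredMoments (D0 m ν) (m / 2) (s * M) (V + (M ^ 2 - 1) / 12) := by
  intro α β γ δ
  have key := h (α * M + γ * (M ^ 3 - M) / 12) (-2 * α + γ * (-6 * M ^ 2 + 2) / 12)
    (γ * M) (-8 * γ / 12)
  rw [pairing_D0]
  convert key using 1
  · congr 2
    funext p
    have e := signedSum_cubic α β γ δ (fab p - m / 2) (m - 2 * (p.1 - p.2))
      (by simp only [fab]; push_cast; ring)
    convert e using 1
    · congr 1
      funext i
      simp only [fab]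
      push_cast
      ring
    · subst hM
      simp only [fab]
      push_cast
      ring
  · ring

theorem HasCentredMoments.D1 {ν : ℤ × ℤ →₀ ℤ} {c s V : ℚ} (h : HasCentredMoments ν c s V)
    (n : ℕ) (M : ℚ) (hM : M = n + 1 + 2 * c) :
    HasCentredMoments (D1 n ν) (-n / 2) (s * M) (V + (M ^ 2 - 1) / 12) := by
  intro α β γ δ
  have key := h (α * M + γ * (M ^ 3 - M) / 12) (2 * α + γ * (6 * M ^ 2 - 2) / 12)
    (γ * M) (8 * γ / 12)
  rw [pairing_D1]
  convert key using 1
  · congr 2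
    funext p
    have e := signedSum_cubic α (-β) γ (-δ) (-fab p - n / 2) (n + 2 * (p.1 - p.2))
      (by simp only [fab]; push_cast; ring)
    convert e using 1
    · congr 1
      funext i
      simp only [fab]
      push_cast
      ring
    · subst hM
      simp only [fab]
      push_cast
      ring
  · ring

theorem HasCentredMoments.var_fab {ν : ℤ × ℤ →₀ ℤ} {c s V : ℚ}
    (h : HasCentredMoments ν c s V) (hs : s ≠ 0) : var ν fab = V := by
  have h0 := h 1 0 0 0
  have h1 := h c 1 0 0
  have h2 := h (c ^ 2) (2 * c) 1 0
  have e2 : (fun p => c ^ 2 + 2 * c * (fab p - c) + 1 * (fab p - c) ^ 2 + 0 * (fab p - c) ^ 3) =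
      fun p => fab p * fab p := by
    funext p
    ring
  rw [e2] at h2
  simp only [zero_mul, add_zero, one_mul, mul_one, add_sub_cancel] at h0 h1 h2
  rw [var, cov, expVal_eq, expVal_eq, h0, h2, h1]
  field_simp
  ring

theorem hasCentredMoments_mu0 (m n k : ℕ) :
    HasCentredMoments (mu0 m n (k + 1)) (if k % 2 = 0 then (m : ℚ) / 2 else -n / 2)
      ((m + 1) * (m + n + 1) ^ k)
      (((m : ℚ) * (m + 2) + k * (m + n) * (m + n + 2)) / 12) := by
  induction k with
  | zero =>
    have h : HasCentredMoments (single (0, 0) 1) 0 1 0 := by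
      intro α β γ δ
      simp [pairing_single, fab]
    convert h.D0 m (m + 1) (by ring) using 1 <;> simp [mu0]
    ring
  | succ k ih =>
    rw [mu0]
    rcases Nat.mod_two_eq_zero_or_one k with hk | hk
    · have hk' : (k + 1) % 2 = 1 := by omega
      simp only [hk, hk', if_true, one_ne_zero, if_false] at ih ⊢
      convert ih.D1 n (m + n + 1) (by ring) using 1
      · ring
      · push_cast
        ring
    · have hk' : (k + 1) % 2 = 0 := by omega
      simp only [hk, hk', if_true, one_ne_zero, if_false] at ih ⊢
      convert ih.D0 m (m + n + 1) (by ring) using 1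
      · ring
      · push_cast
        ring

/-- `Var_{μ_{N,0}}(a-b) = (m(m+2) + (N-1)(m+n)(m+n+2))/12` for `N ≥ 1`. -/
theorem stmt_11 (m n : ℕ) (N : ℕ) (hN : 1 ≤ N) :
    var (mu0 m n N) fab =
      ((m : ℚ) * ((m : ℚ) + 2) +
        ((N : ℚ) - 1) * ((m : ℚ) + (n : ℚ)) * ((m : ℚ) + (n : ℚ) + 2)) / 12 := by
  obtain ⟨k, rfl⟩ := Nat.exists_eq_add_of_le' hN
  rw [(hasCentredMoments_mu0 m n k).var_fab (by positivity)]
  push_cast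
  ring
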